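/- Suppose n is even. Then for every i ∈ ℤ/nℤ one has y_{i + n/2}² = y_i² in R. (Lemma 5.3(4).) -/

import Mathlib

open scoped BigOperators

noncomputable section

/-- The relations of the `(-1)`-skew polynomial ring: `x_i x_j = - x_j x_i` for `i ≠ j`. -/
inductive SkewRel (k : Type) [Field k] (n : ℕ) :
    FreeAlgebra k (Fin n) → FreeAlgebra k (Fin n) → Prop
  | rel (i j : Fin n) (h : i ≠ j) :
      SkewRel k n (FreeAlgebra.ι k i * FreeAlgebra.ι k j)
        (-(FreeAlgebra.ι k j * FreeAlgebra.ι k i))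

/-- The `(-1)`-skew polynomial ring `R = k_{-1}[x_1, …, x_n]`. -/
abbrev SkewPoly (k : Type) [Field k] (n : ℕ) := RingQuot (SkewRel k n)

/-- The generator `x_{i+1}` of `R = k_{-1}[x_1, …, x_n]` (indexed by `i : Fin n`). -/
def skewX (k : Type) [Field k] (n : ℕ) (i : Fin n) : SkewPoly k n :=
  RingQuot.mkAlgHom k (SkewRel k n) (FreeAlgebra.ι k i)

/-- The element `y_j = Σ_{i=1}^n ξ^{i j} x_i`, for `j : ZMod n`. -/
def skewY (k : Type) [Field k] (n : ℕ) (ξ : k) (j : ZMod n) : SkewPoly k n :=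
  ∑ i : Fin n, (ξ ^ ((i.val + 1) * j.val)) • skewX k n i

/-- For `i : ZMod n`, the left ideal `L_i` of `R` generated by all the products
`y_{j_1} ⋯ y_{j_m}` with `m ≥ 1` and `j_1 + ⋯ + j_m = i` in `ZMod n`. -/
def skewL (k : Type) [Field k] (n : ℕ) (ξ : k) (i : ZMod n) : Ideal (SkewPoly k n) :=
  Ideal.span {r : SkewPoly k n |
    ∃ l : List (ZMod n), l ≠ [] ∧ l.sum = i ∧ r = (l.map (skewY k n ξ)).prod}

end

theorem Finset.sum_sq_of_pairwise_anticommute {ι R : Type*} [Ring R] (s : Finset ι) (f : ι → R)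
    (hf : ∀ i j, i ≠ j → f i * f j = -(f j * f i)) :
    (∑ i ∈ s, f i) ^ 2 = ∑ i ∈ s, f i ^ 2 := by
  classical
  induction s using Finset.induction_on with
  | empty => simp
  | insert a s ha ih =>
    have hcross : f a * ∑ i ∈ s, f i = -((∑ i ∈ s, f i) * f a) := by
      rw [Finset.mul_sum, Finset.sum_mul, ← Finset.sum_neg_distrib]
      exact Finset.sum_congr rfl fun i hi => hf a i fun h => ha (h ▸ hi)
    rw [Finset.sum_insert ha, Finset.sum_insert ha, ← ih, sq, add_mul, mul_add, mul_add, hcross,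
      sq, sq]
    abel

theorem skewX_mul_skewX (k : Type) [Field k] (n : ℕ) {i j : Fin n} (h : i ≠ j) :
    skewX k n i * skewX k n j = -(skewX k n j * skewX k n i) := by
  simpa [skewX] using RingQuot.mkAlgHom_rel k (SkewRel.rel (k := k) i j h)

theorem skewY_sq (k : Type) [Field k] (n : ℕ) (ξ : k) (j : ZMod n) :
    skewY k n ξ j ^ 2 = ∑ i : Fin n, (ξ ^ ((i.val + 1) * (2 * j.val))) • skewX k n i ^ 2 := by
  rw [skewY, Finset.sum_sq_of_pairwise_anticommute]
  · refine Finset.sum_congr rfl fun i _ => ?_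
    rw [smul_pow, ← pow_mul]
    congr 2
    ring
  · intro a b hab
    rw [smul_mul_smul_comm, smul_mul_smul_comm, skewX_mul_skewX k n hab, smul_neg, mul_comm]

theorem ZMod.two_mul_val_add_half_modEq {n : ℕ} [NeZero n] (heven : Even n) (i : ZMod n) :
    2 * (i + ((n / 2 : ℕ) : ZMod n)).val ≡ 2 * i.val [MOD n] := by
  rw [← ZMod.natCast_eq_natCast_iff]
  have h : (2 : ZMod n) * ((n / 2 : ℕ) : ZMod n) = 0 := by
    have := congrArg (Nat.cast : ℕ → ZMod n) (Nat.two_mul_div_two_of_even heven)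
    simpa using this
  simp [mul_add, h]

/-!
STATEMENT 7: Suppose `n` is even.  Then for every `i ∈ ℤ/nℤ` one has
`y_{i + n/2}² = y_i²` in `R`.  (Lemma 5.3(4).)
-/

theorem stmt7 {k : Type} [Field k] (n : ℕ) (hn : 2 ≤ n) (heven : Even n)
    (hchar : ¬ ((ringChar k) ∣ 2 * n))
    (ξ : k) (hξ : IsPrimitiveRoot ξ n) :
    ∀ i : ZMod n, (skewY k n ξ (i + ((n / 2 : ℕ) : ZMod n))) ^ 2 = (skewY k n ξ i) ^ 2 := by
  have : NeZero n := ⟨by omega⟩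
  intro i
  rw [skewY_sq, skewY_sq]
  refine Finset.sum_congr rfl fun a _ => congrArg (· • skewX k n a ^ 2) ?_
  have hmod := (ZMod.two_mul_val_add_half_modEq heven i).mul_left (a.val + 1)
  rw [pow_eq_pow_mod _ hξ.pow_eq_one, hmod, ← pow_eq_pow_mod _ hξ.pow_eq_one]
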